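/- Let G be an ℓ-local subgroup of S_n and let μ₀ be the uniform probability measure on G. Then for every nonempty subset A ⊆ G, every α ∈ (0,1) and every t ≥ 0: ∑_{σ∈G} exp( α·f(σ,A)/(2c²) ) μ₀(σ) ≤ μ₀(A)^{−α/(1−α)}, and consequently μ₀({σ ∈ G : f(σ,A) ≥ t}) ≤ exp(−αt/(2c²)) · μ₀(A)^{−α/(1−α)}, where c² = 2(ℓ−1)² + 2. -/

import Mathlib

attribute [local instance] Classical.propDecidable

noncomputable section

/-- Degree (cardinality of the support) of a permutation. -/
noncomputable def degree {n : ℕ} (σ : Equiv.Perm (Fin n)) : ℕ :=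
  (Finset.univ.filter fun i => σ i ≠ i).card

/-- `G` is an `ℓ`-local group of permutations. -/
def IsLLocal {n : ℕ} (ℓ : ℕ) (G : Subgroup (Equiv.Perm (Fin n))) : Prop :=
  ∀ σ ∈ G, ∀ i j : Fin n, σ i = j →
    ∃ τ ∈ G, {x | τ x ≠ x} ⊆ {x | σ x ≠ x} ∧ degree τ ≤ ℓ ∧ τ i = j

/-- Talagrand's convex-hull distance functional `f(σ, A)`. -/
noncomputable def fTal {n : ℕ} (A : Finset (Equiv.Perm (Fin n)))
    (σ : Equiv.Perm (Fin n)) : ℝ :=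
  sInf {w | ∃ p : Equiv.Perm (Fin n) → ℝ,
    (∀ τ, 0 ≤ p τ) ∧ (∀ τ, τ ∉ A → p τ = 0) ∧ (∑ τ, p τ = 1) ∧
    w = ∑ j : Fin n, (∑ τ, p τ * (if σ j ≠ τ j then (1 : ℝ) else 0)) ^ 2}

/-- The one-variable inequality behind the optimisation of the mixing weight. -/
lemma exp_sub_le_one_add {α s : ℝ} (h0 : 0 < α) (h1 : α < 1) (hs : 0 ≤ s) (hs1 : s ≤ 1) :
    Real.exp (α * s - α * s ^ 2 / 2) ≤ 1 + α / (1 - α) * (1 - Real.exp (-((1 - α) * s))) := by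
  have ha : 0 < 1 - α := by linarith
  set E : ℝ → ℝ := fun s =>
    (1 + α / (1 - α) * (1 - Real.exp (-((1 - α) * s)))) * Real.exp (-(α * s - α * s ^ 2 / 2)) with hE
  have hd : ∀ x, HasDerivAt E
      ((α / (1 - α) * (-(Real.exp (-((1 - α) * x)) * (-((1 - α) * 1))))) *
          Real.exp (-(α * x - α * x ^ 2 / 2)) +
        (1 + α / (1 - α) * (1 - Real.exp (-((1 - α) * x)))) *
          (Real.exp (-(α * x - α * x ^ 2 / 2)) * (-(α * 1 - α * (2 * x) / 2)))) x := by
    intro x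
    have e1 : HasDerivAt (fun x : ℝ => Real.exp (-((1 - α) * x)))
        (Real.exp (-((1 - α) * x)) * (-((1 - α) * 1))) x :=
      (((hasDerivAt_id x).const_mul (1 - α)).neg).exp
    have e2 : HasDerivAt (fun x : ℝ => Real.exp (-(α * x - α * x ^ 2 / 2)))
        (Real.exp (-(α * x - α * x ^ 2 / 2)) * (-(α * 1 - α * (2 * x) / 2))) x := by
      have e3 : HasDerivAt (fun x : ℝ => x ^ 2) (2 * x) x := by
        simpa using hasDerivAt_pow 2 x
      exact ((((hasDerivAt_id x).const_mul α).sub ((e3.const_mul α).div_const 2)).neg).exp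
    exact (((e1.const_sub 1).const_mul (α / (1 - α))).const_add 1).mul e2
  have hmono : MonotoneOn E (Set.Icc 0 1) := by
    refine monotoneOn_of_deriv_nonneg (convex_Icc 0 1)
      (fun x _ => (hd x).continuousAt.continuousWithinAt)
      (fun x _ => (hd x).differentiableAt.differentiableWithinAt) ?_
    intro x hx
    rw [interior_Icc] at hx
    rw [(hd x).deriv]
    have hw := Real.add_one_le_exp (-((1 - α) * x))
    set w := Real.exp (-((1 - α) * x)) with hw'
    have key : 0 ≤ w * (1 - α * x) - (1 - x) := by
      have : 0 ≤ 1 - α * x := by nlinarith [hx.1, hx.2]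
      nlinarith [mul_le_mul_of_nonneg_right hw this, mul_nonneg (mul_nonneg h0.le ha.le) (sq_nonneg x)]
    have : (α / (1 - α) * (-(w * (-((1 - α) * 1))))) *
          Real.exp (-(α * x - α * x ^ 2 / 2)) +
        (1 + α / (1 - α) * (1 - w)) *
          (Real.exp (-(α * x - α * x ^ 2 / 2)) * (-(α * 1 - α * (2 * x) / 2))) =
        Real.exp (-(α * x - α * x ^ 2 / 2)) * (α / (1 - α)) * (w * (1 - α * x) - (1 - x)) := by
      field_simp
      ring
    rw [this]
    positivity
  have h := hmono (Set.left_mem_Icc.2 zero_le_one) ⟨hs, hs1⟩ hs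
  simp only [hE, mul_zero, neg_zero, Real.exp_zero, sub_self, add_zero, ne_eq, OfNat.ofNat_ne_zero,
    not_false_eq_true, zero_pow, zero_div, mul_one] at h
  rwa [Real.exp_neg (α * s - _), ← div_eq_mul_inv, one_le_div (Real.exp_pos _)] at h

/-- Talagrand's optimal mixing weight for the ratio `r` of two conditional measures. -/
lemma exists_mixing_weight {α r : ℝ} (h0 : 0 < α) (h1 : α < 1) (hr : 0 < r) (hr1 : r ≤ 1) :
    ∃ lam : ℝ, 0 ≤ lam ∧ lam ≤ 1 ∧
      Real.exp (lam * (-(α / (1 - α)) * Real.log r) + α / 2 * (1 - lam) ^ 2) ≤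
        1 + α / (1 - α) * (1 - r) := by
  have ha : 0 < 1 - α := by linarith
  have hb : 0 < α / (1 - α) := by positivity
  have hlog : Real.log r ≤ 0 := Real.log_nonpos hr.le hr1
  by_cases hu : -Real.log r ≤ 1 - α
  · set s := -Real.log r / (1 - α) with hs
    have hs0 : 0 ≤ s := div_nonneg (by linarith) ha.le
    have hs1 : s ≤ 1 := (div_le_one ha).2 hu
    have hl : Real.log r = -((1 - α) * s) := by rw [hs]; field_simp
    refine ⟨1 - s, by linarith, by linarith, ?_⟩
    have := exp_sub_le_one_add h0 h1 hs0 hs1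
    rw [← hl, Real.exp_log hr] at this
    refine le_trans (le_of_eq ?_) this
    rw [hl]
    congr 1
    field_simp
    ring
  · refine ⟨0, le_rfl, zero_le_one, ?_⟩
    have := exp_sub_le_one_add h0 h1 zero_le_one le_rfl
    have hle : r ≤ Real.exp (-((1 - α) * 1)) := by
      rw [← Real.exp_log hr, Real.exp_le_exp]; linarith
    have h2 : (0 : ℝ) * (-(α / (1 - α)) * Real.log r) + α / 2 * (1 - 0) ^ 2 =
        α * 1 - α * 1 ^ 2 / 2 := by ring
    rw [h2]
    refine this.trans ?_
    gcongr

section PermutationGroups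

variable {n : ℕ}

/-- The probability vectors on permutations that are supported on `A`. -/
def IsProbOn (A : Finset (Equiv.Perm (Fin n))) (p : Equiv.Perm (Fin n) → ℝ) : Prop :=
  (∀ τ, 0 ≤ p τ) ∧ (∀ τ, τ ∉ A → p τ = 0) ∧ (∑ τ, p τ = 1)

/-- The `p`-probability of disagreeing with `σ` at position `j`. -/
def disagreement (p : Equiv.Perm (Fin n) → ℝ) (σ : Equiv.Perm (Fin n)) (j : Fin n) : ℝ :=
  ∑ τ, p τ * (if σ j ≠ τ j then (1 : ℝ) else 0)

/-- The sum of the squared disagreement probabilities, with position `i` counted twice. -/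
def doubledCost (p : Equiv.Perm (Fin n) → ℝ) (σ : Equiv.Perm (Fin n)) (i : Fin n) : ℝ :=
  ∑ j, disagreement p σ j ^ 2 + disagreement p σ i ^ 2

lemma IsProbOn.mono {A B : Finset (Equiv.Perm (Fin n))} {p : Equiv.Perm (Fin n) → ℝ}
    (hp : IsProbOn A p) (h : A ⊆ B) : IsProbOn B p :=
  ⟨hp.1, fun τ hτ => hp.2.1 τ fun h' => hτ (h h'), hp.2.2⟩

lemma IsProbOn.mix {A : Finset (Equiv.Perm (Fin n))} {S : Finset (Fin n)} (hS : S.Nonempty)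
    {p₁ p₂ : Fin n → Equiv.Perm (Fin n) → ℝ} (h₁ : ∀ v, IsProbOn A (p₁ v))
    (h₂ : ∀ v, IsProbOn A (p₂ v)) {lam : ℝ} (h0 : 0 ≤ lam) (h1 : lam ≤ 1) :
    IsProbOn A fun τ => (S.card : ℝ)⁻¹ * ∑ v ∈ S, (lam * p₁ v τ + (1 - lam) * p₂ v τ) := by
  have hc : (S.card : ℝ) ≠ 0 := by exact_mod_cast hS.card_ne_zero
  refine ⟨fun τ => ?_, fun τ hτ => ?_, ?_⟩
  · refine mul_nonneg (by positivity) (Finset.sum_nonneg fun v _ => ?_)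
    have := mul_nonneg h0 ((h₁ v).1 τ)
    have := mul_nonneg (sub_nonneg.2 h1) ((h₂ v).1 τ)
    linarith
  · simp [(h₁ _).2.1 τ hτ, (h₂ _).2.1 τ hτ]
  · rw [← Finset.mul_sum, Finset.sum_comm]
    simp [Finset.sum_add_distrib, ← Finset.mul_sum, (h₁ _).2.2, (h₂ _).2.2, hc]

lemma disagreement_mix (S : Finset (Fin n)) (p₁ p₂ : Fin n → Equiv.Perm (Fin n) → ℝ) (lam : ℝ)
    (σ : Equiv.Perm (Fin n)) (j : Fin n) :
    disagreement (fun τ => (S.card : ℝ)⁻¹ * ∑ v ∈ S, (lam * p₁ v τ + (1 - lam) * p₂ v τ)) σ j =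
      (S.card : ℝ)⁻¹ *
        ∑ v ∈ S, (lam * disagreement (p₁ v) σ j + (1 - lam) * disagreement (p₂ v) σ j) := by
  unfold disagreement
  simp only [Finset.mul_sum, Finset.sum_mul, ← Finset.sum_add_distrib]
  rw [Finset.sum_comm]
  refine Finset.sum_congr rfl fun v _ => Finset.sum_congr rfl fun τ _ => ?_
  ring

lemma disagreement_nonneg {A : Finset (Equiv.Perm (Fin n))} {p : Equiv.Perm (Fin n) → ℝ}
    (hp : IsProbOn A p) (σ : Equiv.Perm (Fin n)) (j : Fin n) : 0 ≤ disagreement p σ j :=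
  Finset.sum_nonneg fun τ _ => mul_nonneg (hp.1 τ) (by split_ifs <;> norm_num)

lemma disagreement_le_one {A : Finset (Equiv.Perm (Fin n))} {p : Equiv.Perm (Fin n) → ℝ}
    (hp : IsProbOn A p) (σ : Equiv.Perm (Fin n)) (j : Fin n) : disagreement p σ j ≤ 1 := by
  rw [← hp.2.2]
  exact Finset.sum_le_sum fun τ _ => mul_le_of_le_one_right (hp.1 τ) (by split_ifs <;> norm_num)

lemma disagreement_congr {p : Equiv.Perm (Fin n) → ℝ} {σ σ' : Equiv.Perm (Fin n)} {j : Fin n}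
    (h : σ j = σ' j) : disagreement p σ j = disagreement p σ' j := by
  simp [disagreement, h]

lemma disagreement_eq_zero {A : Finset (Equiv.Perm (Fin n))} {p : Equiv.Perm (Fin n) → ℝ}
    (hp : IsProbOn A p) {σ : Equiv.Perm (Fin n)} {j : Fin n} (h : ∀ τ ∈ A, τ j = σ j) :
    disagreement p σ j = 0 := by
  refine Finset.sum_eq_zero fun τ _ => ?_
  by_cases hτ : τ ∈ A
  · simp [h τ hτ]
  · simp [hp.2.1 τ hτ]

lemma fTal_le_doubledCost {A : Finset (Equiv.Perm (Fin n))} {p : Equiv.Perm (Fin n) → ℝ}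
    (hp : IsProbOn A p) (σ : Equiv.Perm (Fin n)) (i : Fin n) : fTal A σ ≤ doubledCost p σ i := by
  refine le_trans ?_ (le_add_of_nonneg_right (sq_nonneg (disagreement p σ i)))
  refine csInf_le ⟨0, ?_⟩ ⟨p, hp.1, hp.2.1, hp.2.2, rfl⟩
  rintro w ⟨q, -, -, -, rfl⟩
  exact Finset.sum_nonneg fun j _ => sq_nonneg _

/-- The convexity estimate for a permutation `σ` and its left translate `g * σ`: the values moved
by `g` other than `σ i` are spread over single doubled positions. -/
lemma doubledCost_mix_le {A : Finset (Equiv.Perm (Fin n))} {S : Finset (Fin n)} (hS : S.Nonempty)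
    {σ g : Equiv.Perm (Fin n)} {i : Fin n} (hg : ∀ x, g x ≠ x → x = σ i ∨ x ∈ S)
    {p₁ p₂ : Fin n → Equiv.Perm (Fin n) → ℝ} (h₁ : ∀ v, IsProbOn A (p₁ v))
    (h₂ : ∀ v, IsProbOn A (p₂ v)) {lam : ℝ} (h0 : 0 ≤ lam) (h1 : lam ≤ 1)
    (hi : ∀ v, lam * disagreement (p₁ v) σ i = 0) :
    doubledCost (fun τ => (S.card : ℝ)⁻¹ * ∑ v ∈ S, (lam * p₁ v τ + (1 - lam) * p₂ v τ)) σ i ≤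
      (S.card : ℝ)⁻¹ * ∑ v ∈ S, (lam * doubledCost (p₁ v) σ (σ⁻¹ v) +
        (1 - lam) * doubledCost (p₂ v) (g * σ) (σ⁻¹ v)) +
      (2 * (S.card : ℝ) ^ 2 + 2) * (1 - lam) ^ 2 := by
  have hc : (0 : ℝ) < S.card := by exact_mod_cast hS.card_pos
  set K : ℝ := (S.card : ℝ) with hK
  have hl : 0 ≤ 1 - lam := sub_nonneg.2 h1
  set r : Equiv.Perm (Fin n) → ℝ :=
    fun τ => K⁻¹ * ∑ v ∈ S, (lam * p₁ v τ + (1 - lam) * p₂ v τ) with hr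
  have hrA : IsProbOn A r := IsProbOn.mix hS h₁ h₂ h0 h1
  have hri : disagreement r σ i ^ 2 ≤ (1 - lam) ^ 2 := by
    refine pow_le_pow_left₀ (disagreement_nonneg hrA _ _) ?_ 2
    rw [hr, disagreement_mix, ← hK, inv_mul_le_iff₀ hc]
    calc _ ≤ ∑ v ∈ S, (1 - lam) := Finset.sum_le_sum fun v _ => by
          rw [hi v, zero_add]
          exact mul_le_of_le_one_right hl (disagreement_le_one (h₂ v) _ _)
      _ = K * (1 - lam) := by rw [Finset.sum_const, nsmul_eq_mul]
  set a : Fin n → Fin n → ℝ := fun v m => disagreement (p₁ v) σ m with ha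
  set b : Fin n → Fin n → ℝ := fun v m => disagreement (p₂ v) (g * σ) m with hb
  set L : ℝ := (1 - lam) * K with hL
  set B : Fin n → ℝ := fun m => K⁻¹ * ∑ v ∈ S,
    (lam * (a v m ^ 2 + if m = σ⁻¹ v then a v m ^ 2 + 2 * L ^ 2 else 0) +
      (1 - lam) * (b v m ^ 2 + if m = σ⁻¹ v then b v m ^ 2 + 2 * L ^ 2 else 0)) with hB
  have hB0 : ∀ m, 0 ≤ B m := fun m => by
    refine mul_nonneg (by positivity) (Finset.sum_nonneg fun v _ => add_nonneg
      (mul_nonneg h0 ?_) (mul_nonneg hl ?_)) <;> split_ifs <;> positivity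
  have hpt : ∀ m, disagreement r σ m ^ 2 ≤ B m + if m = i then (1 - lam) ^ 2 else 0 := by
    intro m
    by_cases hm : m = i
    · rw [if_pos hm, hm]; linarith [hB0 i]
    rw [if_neg hm, add_zero]
    set e : Fin n → ℝ := fun v => if m = σ⁻¹ v then L else 0 with he
    have hb2 : ∀ v, disagreement (p₂ v) σ m ≤ b v m + if σ m ∈ S then 1 else 0 := by
      intro v
      by_cases hmS : σ m ∈ S
      · rw [if_pos hmS]
        linarith [disagreement_le_one (h₂ v) σ m, disagreement_nonneg (h₂ v) (g * σ) m]
      · rw [if_neg hmS, add_zero]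
        refine (disagreement_congr ?_).le
        by_contra hne
        rcases hg (σ m) (fun h => hne (by simp [h])) with h | h
        · exact hm (σ.injective h)
        · exact hmS h
    have hsum : ∑ v ∈ S, e v = L * if σ m ∈ S then 1 else 0 := by
      have : ∀ v, e v = if σ m = v then L else 0 := fun v => by
        simp only [he, Equiv.Perm.eq_inv_iff_eq]
      simp [this]
    have hle : disagreement r σ m ≤
        K⁻¹ * ∑ v ∈ S, (lam * (a v m + e v) + (1 - lam) * (b v m + e v)) := by
      rw [hr, disagreement_mix, ← hK]
      refine mul_le_mul_of_nonneg_left ?_ (by positivity)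
      have : ∑ v ∈ S, (lam * (a v m + e v) + (1 - lam) * (b v m + e v)) =
          ∑ v ∈ S, (lam * a v m + (1 - lam) * (b v m + if σ m ∈ S then 1 else 0)) := by
        have h3 : ∀ v, lam * (a v m + e v) + (1 - lam) * (b v m + e v) =
          lam * a v m + (1 - lam) * b v m + e v := fun v => by ring
        have h4 : ∀ v, lam * a v m + (1 - lam) * (b v m + if σ m ∈ S then (1 : ℝ) else 0) =
          lam * a v m + (1 - lam) * b v m + (1 - lam) * if σ m ∈ S then (1 : ℝ) else 0 :=
          fun v => by ring
        simp only [h3, h4]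
        rw [Finset.sum_add_distrib, hsum,
          Finset.sum_add_distrib (g := fun _ => (1 - lam) * if σ m ∈ S then (1 : ℝ) else 0),
          Finset.sum_const, nsmul_eq_mul, hL]
        ring
      rw [this]
      refine Finset.sum_le_sum fun v _ => ?_
      linarith [mul_le_mul_of_nonneg_left (hb2 v) hl]
    refine (pow_le_pow_left₀ (disagreement_nonneg hrA _ _) hle 2).trans ?_
    have hcs := sq_sum_le_card_mul_sum_sq (s := S)
      (f := fun v => lam * (a v m + e v) + (1 - lam) * (b v m + e v))
    rw [mul_pow]
    calc _ ≤ K⁻¹ ^ 2 * (K * ∑ v ∈ S, (lam * (a v m + e v) + (1 - lam) * (b v m + e v)) ^ 2) :=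
          mul_le_mul_of_nonneg_left hcs (by positivity)
      _ = K⁻¹ * ∑ v ∈ S, (lam * (a v m + e v) + (1 - lam) * (b v m + e v)) ^ 2 := by
          field_simp
      _ ≤ B m := by
          refine mul_le_mul_of_nonneg_left (Finset.sum_le_sum fun v _ => ?_) (by positivity)
          have hconv : (lam * (a v m + e v) + (1 - lam) * (b v m + e v)) ^ 2 ≤
              lam * (a v m + e v) ^ 2 + (1 - lam) * (b v m + e v) ^ 2 := by
            nlinarith [mul_nonneg (mul_nonneg h0 hl) (sq_nonneg (a v m - b v m))]
          have hdbl : ∀ x : ℝ, (x + e v) ^ 2 ≤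
              x ^ 2 + if m = σ⁻¹ v then x ^ 2 + 2 * L ^ 2 else 0 := by
            intro x
            simp only [he]
            split_ifs
            · nlinarith [sq_nonneg (x - L)]
            · simp
          linarith [mul_le_mul_of_nonneg_left (hdbl (a v m)) h0,
            mul_le_mul_of_nonneg_left (hdbl (b v m)) hl]
  have hBsum : ∑ m, B m = K⁻¹ * ∑ v ∈ S, (lam * doubledCost (p₁ v) σ (σ⁻¹ v) +
        (1 - lam) * doubledCost (p₂ v) (g * σ) (σ⁻¹ v)) + 2 * L ^ 2 := by
    simp only [hB]
    rw [← Finset.mul_sum, Finset.sum_comm]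
    have : ∀ v ∈ S, ∑ m, (lam * (a v m ^ 2 + if m = σ⁻¹ v then a v m ^ 2 + 2 * L ^ 2 else 0) +
        (1 - lam) * (b v m ^ 2 + if m = σ⁻¹ v then b v m ^ 2 + 2 * L ^ 2 else 0)) =
        (lam * doubledCost (p₁ v) σ (σ⁻¹ v) + (1 - lam) * doubledCost (p₂ v) (g * σ) (σ⁻¹ v)) +
          2 * L ^ 2 := by
      intro v _
      simp only [Finset.sum_add_distrib, ← Finset.mul_sum, doubledCost, Finset.sum_ite_eq',
        Finset.mem_univ, if_true, ha, hb]
      ring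
    rw [Finset.sum_congr rfl this, Finset.sum_add_distrib, Finset.sum_const, nsmul_eq_mul, ← hK]
    field_simp
  have htot : ∑ m, disagreement r σ m ^ 2 ≤ ∑ m, B m + (1 - lam) ^ 2 := by
    refine (Finset.sum_le_sum fun m _ => hpt m).trans (le_of_eq ?_)
    simp [Finset.sum_add_distrib]
  rw [hBsum] at htot
  unfold doubledCost at *
  have : 2 * L ^ 2 = 2 * K ^ 2 * (1 - lam) ^ 2 := by rw [hL]; ring
  linarith

/-- The elements of a subgroup, as a finite set. -/
def elems (G : Subgroup (Equiv.Perm (Fin n))) : Finset (Equiv.Perm (Fin n)) :=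
  Finset.univ.filter (· ∈ G)

lemma mem_elems {G : Subgroup (Equiv.Perm (Fin n))} {σ : Equiv.Perm (Fin n)} :
    σ ∈ elems G ↔ σ ∈ G := by simp [elems]

lemma card_elems_pos (G : Subgroup (Equiv.Perm (Fin n))) : 0 < (elems G).card :=
  Finset.card_pos.2 ⟨1, mem_elems.2 G.one_mem⟩

/-- The inductive form of the concentration inequality: random elements of `A` with a small
exponential moment of the cost doubled at position `i`. -/
def ExpMomentBound (κ β : ℝ) (G : Subgroup (Equiv.Perm (Fin n)))
    (A : Finset (Equiv.Perm (Fin n))) (i : Fin n) : Prop :=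
  ∃ q : Equiv.Perm (Fin n) → Equiv.Perm (Fin n) → ℝ, (∀ σ, IsProbOn A (q σ)) ∧
    ∑ σ ∈ elems G, Real.exp (κ * doubledCost (q σ) σ i) ≤
      (elems G).card * ((A.card : ℝ) / (elems G).card) ^ (-β)

/-- Inversion turns the bound with a doubled position on `H` into the bound with a doubled value on
a coset of `H`. -/
lemma exists_kernel_on_coset {κ β : ℝ} {H : Subgroup (Equiv.Perm (Fin n))}
    (hH : ∀ B : Finset (Equiv.Perm (Fin n)), (∀ σ ∈ B, σ ∈ H) → B.Nonempty → ∀ i,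
      ExpMomentBound κ β H B i)
    {C : Finset (Equiv.Perm (Fin n))} {g : Equiv.Perm (Fin n)} (hC : ∀ σ, σ ∈ C ↔ σ⁻¹ * g ∈ H)
    {B : Finset (Equiv.Perm (Fin n))} (hBC : B ⊆ C) (hB : B.Nonempty) (v : Fin n) :
    ∃ q : Equiv.Perm (Fin n) → Equiv.Perm (Fin n) → ℝ, (∀ σ, IsProbOn B (q σ)) ∧
      ∑ σ ∈ C, Real.exp (κ * doubledCost (q σ) σ (σ⁻¹ v)) ≤
        (elems H).card * ((B.card : ℝ) / (elems H).card) ^ (-β) := by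
  set φ : Equiv.Perm (Fin n) ≃ Equiv.Perm (Fin n) :=
    (Equiv.inv _).trans (Equiv.mulRight g) with hφ
  have hφa : ∀ y, φ y = y⁻¹ * g := fun y => rfl
  obtain ⟨q, hq, hsum⟩ := hH (B.map φ.toEmbedding)
    (by
      intro σ hσ
      obtain ⟨y, hy, rfl⟩ := Finset.mem_map.1 hσ
      exact (hC y).1 (hBC hy)) (hB.map) (g⁻¹ v)
  rw [Finset.card_map] at hsum
  have hdis : ∀ σ m, disagreement (fun y => q (φ σ) (φ y)) σ m =
      disagreement (q (φ σ)) (φ σ) ((φ σ)⁻¹ m) := by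
    intro σ m
    unfold disagreement
    rw [← Equiv.sum_comp φ fun z => q (φ σ) z *
      (if φ σ ((φ σ)⁻¹ m) ≠ z ((φ σ)⁻¹ m) then (1 : ℝ) else 0)]
    refine Finset.sum_congr rfl fun y _ => ?_
    congr 1
    have : (σ m ≠ y m) ↔ (φ σ ((φ σ)⁻¹ m) ≠ φ y ((φ σ)⁻¹ m)) := by
      have h1 : φ y ((φ σ)⁻¹ m) = y⁻¹ (σ m) := by simp [hφa]
      rw [h1, ← Equiv.Perm.mul_apply, mul_inv_cancel, Equiv.Perm.one_apply, not_iff_not, Equiv.Perm.eq_inv_iff_eq, eq_comm]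
    simp only [this]
  refine ⟨fun σ y => q (φ σ) (φ y), fun σ => ⟨fun τ => (hq _).1 _, fun τ hτ => ?_, ?_⟩, ?_⟩
  · exact (hq _).2.1 _ fun h => hτ (by simpa using h)
  · rw [Equiv.sum_comp φ (q (φ σ))]
    exact (hq _).2.2
  · refine le_trans (le_of_eq ?_) hsum
    refine Finset.sum_equiv φ (fun σ => by rw [hC, mem_elems, hφa]) fun σ _ => ?_
    congr 2
    unfold doubledCost
    simp only [hdis]
    congr 1
    · exact Equiv.sum_comp (φ σ)⁻¹ fun m => disagreement (q (φ σ)) (φ σ) m ^ 2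
    · congr 2
      simp [hφa]

/-- Mixing the kernels on two cosets. -/
lemma exists_kernel_mix {κ M K lam b₁ b₂ : ℝ} (hκ : 0 ≤ κ) (h0 : 0 ≤ lam)
    (h1 : lam ≤ 1) {A C C' : Finset (Equiv.Perm (Fin n))} {S : Finset (Fin n)} (hS : S.Nonempty)
    (hSM : 2 * (S.card : ℝ) ^ 2 + 2 ≤ M) {g : Equiv.Perm (Fin n)} {i j : Fin n}
    (hC : ∀ σ ∈ C, σ i = j) (hCC : ∀ σ ∈ C, g * σ ∈ C')
    (hg : ∀ x, g x ≠ x → x = j ∨ x ∈ S)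
    (H₁ : ∀ v, ∃ q : Equiv.Perm (Fin n) → Equiv.Perm (Fin n) → ℝ, (∀ σ, IsProbOn A (q σ)) ∧
      (∀ σ ∈ C, lam * disagreement (q σ) σ i = 0) ∧
      lam * ∑ σ ∈ C, Real.exp (κ * doubledCost (q σ) σ (σ⁻¹ v)) ≤ lam * (K * Real.exp b₁))
    (H₂ : ∀ v, ∃ q : Equiv.Perm (Fin n) → Equiv.Perm (Fin n) → ℝ, (∀ σ, IsProbOn A (q σ)) ∧
      ∑ σ ∈ C', Real.exp (κ * doubledCost (q σ) σ (σ⁻¹ v)) ≤ K * Real.exp b₂) :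
    ∃ q : Equiv.Perm (Fin n) → Equiv.Perm (Fin n) → ℝ, (∀ σ, IsProbOn A (q σ)) ∧
      ∑ σ ∈ C, Real.exp (κ * doubledCost (q σ) σ i) ≤
        K * Real.exp (lam * b₁ + (1 - lam) * b₂ + κ * M * (1 - lam) ^ 2) := by
  choose q₁ hq₁ hz hs₁ using H₁
  choose q₂ hq₂ hs₂ using fun v => H₂ (g v)
  have hc : (0 : ℝ) < S.card := by exact_mod_cast hS.card_pos
  have hl : 0 ≤ 1 - lam := sub_nonneg.2 h1
  refine ⟨fun σ τ => (S.card : ℝ)⁻¹ * ∑ v ∈ S, (lam * q₁ v σ τ + (1 - lam) * q₂ v (g * σ) τ),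
    fun σ => IsProbOn.mix hS (fun v => hq₁ v σ) (fun v => hq₂ v (g * σ)) h0 h1, ?_⟩
  set T := lam * b₁ + (1 - lam) * b₂ + κ * M * (1 - lam) ^ 2 with hT
  set F₁ : Fin n → Equiv.Perm (Fin n) → ℝ := fun v σ => κ * doubledCost (q₁ v σ) σ (σ⁻¹ v)
  set F₂ : Fin n → Equiv.Perm (Fin n) → ℝ :=
    fun v σ => κ * doubledCost (q₂ v (g * σ)) (g * σ) (σ⁻¹ v)
  have hpt : ∀ σ ∈ C, Real.exp (κ * doubledCost (fun τ => (S.card : ℝ)⁻¹ *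
      ∑ v ∈ S, (lam * q₁ v σ τ + (1 - lam) * q₂ v (g * σ) τ)) σ i) ≤
      Real.exp T * ((S.card : ℝ)⁻¹ * ∑ v ∈ S,
        (lam * Real.exp (F₁ v σ - b₁) + (1 - lam) * Real.exp (F₂ v σ - b₂))) := by
    intro σ hσ
    have h := doubledCost_mix_le (A := A) hS (σ := σ) (g := g) (i := i)
      (fun x hx => by rw [hC σ hσ]; exact hg x hx) (p₁ := fun v => q₁ v σ)
      (p₂ := fun v => q₂ v (g * σ)) (fun v => hq₁ v σ) (fun v => hq₂ v (g * σ)) h0 h1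
      (fun v => hz v σ hσ)
    have h' := mul_le_mul_of_nonneg_left (h.trans (add_le_add_right
      (mul_le_mul_of_nonneg_right hSM (sq_nonneg (1 - lam))) _)) hκ
    have hexp : κ * ((S.card : ℝ)⁻¹ * ∑ v ∈ S, (lam * doubledCost (q₁ v σ) σ (σ⁻¹ v) +
        (1 - lam) * doubledCost (q₂ v (g * σ)) (g * σ) (σ⁻¹ v)) + M * (1 - lam) ^ 2) =
        T + ∑ v ∈ S, (S.card : ℝ)⁻¹ * (lam * (F₁ v σ - b₁) + (1 - lam) * (F₂ v σ - b₂)) := by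
      have h3 : ∀ v, lam * (F₁ v σ - b₁) + (1 - lam) * (F₂ v σ - b₂) =
          κ * (lam * doubledCost (q₁ v σ) σ (σ⁻¹ v) +
            (1 - lam) * doubledCost (q₂ v (g * σ)) (g * σ) (σ⁻¹ v)) -
            (lam * b₁ + (1 - lam) * b₂) := fun v => by
        simp only [F₁, F₂]; ring
      rw [← Finset.mul_sum]
      simp only [h3]
      rw [Finset.sum_sub_distrib, ← Finset.mul_sum, Finset.sum_const, nsmul_eq_mul, hT]
      field_simp
      ring
    refine (Real.exp_le_exp.2 (h'.trans hexp.le)).trans ?_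
    rw [Real.exp_add]
    refine mul_le_mul_of_nonneg_left ?_ (Real.exp_pos _).le
    have hj := convexOn_exp.map_sum_le (t := S) (w := fun _ => (S.card : ℝ)⁻¹)
      (p := fun v => lam * (F₁ v σ - b₁) + (1 - lam) * (F₂ v σ - b₂))
      (fun _ _ => by positivity) (by simp [hc.ne']) (fun _ _ => Set.mem_univ _)
    simp only [smul_eq_mul] at hj
    refine hj.trans ?_
    rw [← Finset.mul_sum]
    refine mul_le_mul_of_nonneg_left (Finset.sum_le_sum fun v _ => ?_) (by positivity)
    exact convexOn_exp.2 (Set.mem_univ _) (Set.mem_univ _) h0 hl (by ring)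
  refine (Finset.sum_le_sum hpt).trans ?_
  rw [← Finset.mul_sum, ← Finset.mul_sum, Finset.sum_comm, mul_comm K]
  refine mul_le_mul_of_nonneg_left ?_ (Real.exp_pos _).le
  rw [inv_mul_le_iff₀ hc]
  have hv : ∀ v ∈ S, ∑ σ ∈ C, (lam * Real.exp (F₁ v σ - b₁) +
      (1 - lam) * Real.exp (F₂ v σ - b₂)) ≤ K := by
    intro v _
    have e1 : lam * ∑ σ ∈ C, Real.exp (F₁ v σ - b₁) ≤ lam * K := by
      have := mul_le_mul_of_nonneg_right (hs₁ v) (Real.exp_pos (-b₁)).le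
      rw [mul_assoc, Finset.sum_mul, mul_assoc, mul_assoc, ← Real.exp_add, add_neg_cancel,
        Real.exp_zero, mul_one] at this
      simpa only [sub_eq_add_neg, Real.exp_add] using this
    have e2 : ∑ σ ∈ C, Real.exp (F₂ v σ - b₂) ≤ K := by
      have := mul_le_mul_of_nonneg_right (hs₂ v) (Real.exp_pos (-b₂)).le
      rw [Finset.sum_mul, mul_assoc, ← Real.exp_add, add_neg_cancel,
        Real.exp_zero, mul_one] at this
      refine le_trans ?_ this
      calc ∑ σ ∈ C, Real.exp (F₂ v σ - b₂) = ∑ ρ ∈ C.image (g * ·),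
            Real.exp (κ * doubledCost (q₂ v ρ) ρ (ρ⁻¹ (g v))) * Real.exp (-b₂) := by
            rw [Finset.sum_image fun x _ y _ h => mul_left_cancel h]
            refine Finset.sum_congr rfl fun σ _ => ?_
            simp [F₂, sub_eq_add_neg, Real.exp_add]
        _ ≤ _ := Finset.sum_le_sum_of_subset_of_nonneg
            (fun ρ hρ => by obtain ⟨σ, hσ, rfl⟩ := Finset.mem_image.1 hρ; exact hCC σ hσ)
            fun _ _ _ => by positivity
    rw [Finset.sum_add_distrib, ← Finset.mul_sum, ← Finset.mul_sum]
    linarith [mul_le_mul_of_nonneg_left e2 hl]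
  calc _ ≤ ∑ v ∈ S, K := Finset.sum_le_sum hv
    _ = _ := by simp

lemma IsLLocal.inf_stabilizer {ℓ : ℕ} {G : Subgroup (Equiv.Perm (Fin n))} (hG : IsLLocal ℓ G)
    (i : Fin n) : IsLLocal ℓ (G ⊓ MulAction.stabilizer (Equiv.Perm (Fin n)) i) := by
  intro σ hσ a b hab
  obtain ⟨τ, hτ, hsub, hdeg, hτa⟩ := hG σ hσ.1 a b hab
  refine ⟨τ, ⟨hτ, ?_⟩, hsub, hdeg, hτa⟩
  by_contra h
  exact hsub (show τ i ≠ i from h) hσ.2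

/-- Locality provides an element taking `j` to `k` that moves at most `ℓ - 1` other points. -/
lemma IsLLocal.exists_map_eq {ℓ : ℕ} (hℓ : 2 ≤ ℓ) {G : Subgroup (Equiv.Perm (Fin n))}
    (hG : IsLLocal ℓ G) {ρ : Equiv.Perm (Fin n)} (hρ : ρ ∈ G) {j k : Fin n} (hjk : ρ j = k) :
    ∃ g ∈ G, ∃ S : Finset (Fin n), g j = k ∧ S.Nonempty ∧ S.card + 1 ≤ ℓ ∧
      ∀ x, g x ≠ x → x = j ∨ x ∈ S := by
  by_cases h : j = k
  · exact ⟨1, G.one_mem, {j}, h, by simp, by simpa using hℓ, fun x hx => by simp at hx⟩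
  obtain ⟨τ, hτ, -, hdeg, hτj⟩ := hG ρ hρ j k hjk
  have hj : j ∈ Finset.univ.filter fun i => τ i ≠ i := by simp [hτj, Ne.symm h]
  refine ⟨τ, hτ, (Finset.univ.filter fun i => τ i ≠ i).erase j, hτj, ⟨k, ?_⟩, ?_, fun x hx => ?_⟩
  · have : τ k ≠ k := fun h' => h (τ.injective (hτj.trans h'.symm))
    simp [this, Ne.symm h]
  · rwa [Finset.card_erase_add_one hj]
  · by_cases hxj : x = j
    · exact Or.inl hxj
    · exact Or.inr (by simp [hx, hxj])

lemma one_add_mul_le_rpow_neg {β r : ℝ} (hβ : 0 ≤ β) (hr : 0 < r) :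
    1 + β * (1 - r) ≤ r ^ (-β) := by
  rw [Real.rpow_def_of_pos hr]
  have h1 := Real.add_one_le_exp (Real.log r * -β)
  nlinarith [mul_le_mul_of_nonneg_left (Real.log_le_sub_one_of_pos hr) hβ]

lemma sum_mixing_bounds_le {ι : Type*} {O : Finset ι} {β a d₀ h : ℝ} (hβ : 0 ≤ β)
    (hO : O.Nonempty) (d : ι → ℝ) (had : a = ∑ j ∈ O, d j) (ha : 0 < a) (hd₀ : 0 < d₀)
    (hh : 0 < h) :
    ∑ j ∈ O, h * ((d₀ / h) ^ (-β) * (1 + β * (1 - d j / d₀))) ≤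
      O.card * h * (a / (O.card * h)) ^ (-β) := by
  have hc : (0 : ℝ) < O.card := by exact_mod_cast hO.card_pos
  have hr : 0 < a / (O.card * d₀) := by positivity
  calc _ = O.card * h * ((d₀ / h) ^ (-β) * (1 + β * (1 - a / (O.card * d₀)))) := by
        have hsum : ∑ j ∈ O, d j / d₀ = O.card * (a / (O.card * d₀)) := by
          rw [← Finset.sum_div, ← had]
          field_simp
        rw [← Finset.mul_sum, ← Finset.mul_sum, Finset.sum_add_distrib, ← Finset.mul_sum,
          Finset.sum_sub_distrib, hsum]
        simp only [Finset.sum_const, nsmul_eq_mul, mul_one]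
        ring
    _ ≤ O.card * h * ((d₀ / h) ^ (-β) * (a / (O.card * d₀)) ^ (-β)) := by
        gcongr
        exact one_add_mul_le_rpow_neg hβ hr
    _ = _ := by
        rw [← Real.mul_rpow (by positivity) hr.le]
        congr 2
        field_simp

set_option maxHeartbeats 400000 in
/-- The inductive step: decompose the group along the value of `σ i`. -/
lemma expMomentBound_of_stabilizer {ℓ : ℕ} (hℓ : 2 ≤ ℓ) {α : ℝ} (h0 : 0 < α) (h1 : α < 1)
    {G : Subgroup (Equiv.Perm (Fin n))} (hG : IsLLocal ℓ G) {i : Fin n}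
    (hH : ∀ B : Finset (Equiv.Perm (Fin n)),
      (∀ σ ∈ B, σ ∈ G ⊓ MulAction.stabilizer (Equiv.Perm (Fin n)) i) → B.Nonempty → ∀ i',
      ExpMomentBound (α / (2 * (2 * ((ℓ : ℝ) - 1) ^ 2 + 2))) (α / (1 - α))
        (G ⊓ MulAction.stabilizer (Equiv.Perm (Fin n)) i) B i')
    {A : Finset (Equiv.Perm (Fin n))} (hAG : ∀ σ ∈ A, σ ∈ G) (hA : A.Nonempty) :
    ExpMomentBound (α / (2 * (2 * ((ℓ : ℝ) - 1) ^ 2 + 2))) (α / (1 - α)) G A i := by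
  set H := G ⊓ MulAction.stabilizer (Equiv.Perm (Fin n)) i with hHdef
  set M : ℝ := 2 * ((ℓ : ℝ) - 1) ^ 2 + 2 with hM
  have hMpos : 0 < M := by positivity
  set κ := α / (2 * M) with hκ
  have hκ0 : 0 ≤ κ := by positivity
  have hκM : κ * M = α / 2 := by rw [hκ]; field_simp
  set β := α / (1 - α) with hβ
  have hβ0 : 0 ≤ β := div_nonneg h0.le (by linarith)
  set C : Fin n → Finset (Equiv.Perm (Fin n)) := fun j => (elems G).filter fun σ => σ i = j
  set D : Fin n → Finset (Equiv.Perm (Fin n)) := fun j => A.filter fun σ => σ i = j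
  set O : Finset (Fin n) := Finset.univ.filter fun j => ∃ σ ∈ G, σ i = j
  have hO : ∀ {j}, j ∈ O ↔ ∃ σ ∈ G, σ i = j := by simp [O]
  have hDC : ∀ j, D j ⊆ C j := fun j => by
    intro σ hσ
    simp only [D, C, Finset.mem_filter, mem_elems] at hσ ⊢
    exact ⟨hAG σ hσ.1, hσ.2⟩
  have hDA : ∀ j, D j ⊆ A := fun j => Finset.filter_subset _ _
  have hcoset : ∀ {j g}, g ∈ G → g i = j → ∀ σ, σ ∈ C j ↔ σ⁻¹ * g ∈ H := by
    intro j g hg hgi σ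
    simp only [C, Finset.mem_filter, mem_elems, hHdef, Subgroup.mem_inf,
      MulAction.mem_stabilizer_iff, Equiv.Perm.smul_def, Equiv.Perm.mul_apply, hgi,
      Equiv.Perm.inv_eq_iff_eq, G.mul_mem_cancel_right hg, G.inv_mem_iff]
    tauto
  have hCcard : ∀ j ∈ O, (C j).card = (elems H).card := by
    intro j hj
    obtain ⟨g, hg, hgi⟩ := hO.1 hj
    exact Finset.card_equiv ((Equiv.inv _).trans (Equiv.mulRight g)) fun σ => by
      rw [hcoset hg hgi, mem_elems]; rfl
  have hmapsG : ∀ σ ∈ elems G, σ i ∈ O := fun σ hσ => hO.2 ⟨σ, mem_elems.1 hσ, rfl⟩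
  have hGcard : (elems G).card = O.card * (elems H).card := by
    rw [Finset.card_eq_sum_card_fiberwise hmapsG, Finset.sum_congr rfl hCcard]
    simp
  have hAcard : A.card = ∑ j ∈ O, (D j).card :=
    Finset.card_eq_sum_card_fiberwise fun σ hσ => hmapsG σ (mem_elems.2 (hAG σ hσ))
  have hOne : O.Nonempty := ⟨i, hO.2 ⟨1, G.one_mem, rfl⟩⟩
  obtain ⟨k, hk, hmax⟩ := O.exists_max_image (fun j => (D j).card) hOne
  have hDk : 0 < (D k).card := by
    obtain ⟨a, ha⟩ := hA
    have haD : a ∈ D (a i) := Finset.mem_filter.2 ⟨ha, rfl⟩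
    exact lt_of_lt_of_le (Finset.card_pos.2 ⟨a, haD⟩)
      (hmax (a i) (hmapsG a (mem_elems.2 (hAG a ha))))
  have hK : (0 : ℝ) < (elems H).card := by exact_mod_cast card_elems_pos H
  have hDk' : (0 : ℝ) < (D k).card := by exact_mod_cast hDk
  set x : Fin n → ℝ := fun j => ((D j).card : ℝ) / (elems H).card with hx
  have hxk : 0 < x k := by positivity
  obtain ⟨gk, hgk, hgki⟩ := hO.1 hk
  have hk2 : ∀ v, ∃ q : Equiv.Perm (Fin n) → Equiv.Perm (Fin n) → ℝ,
      (∀ σ, IsProbOn A (q σ)) ∧ ∑ σ ∈ C k, Real.exp (κ * doubledCost (q σ) σ (σ⁻¹ v)) ≤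
        (elems H).card * Real.exp (Real.log (x k) * -β) := fun v => by
    obtain ⟨q, hq, hs⟩ := exists_kernel_on_coset hH (hcoset hgk hgki) (hDC k)
      (Finset.card_pos.1 hDk) v
    exact ⟨q, fun σ => (hq σ).mono (hDA k), by rwa [← Real.rpow_def_of_pos hxk]⟩
  have hstep : ∀ j ∈ O, ∃ q : Equiv.Perm (Fin n) → Equiv.Perm (Fin n) → ℝ,
      (∀ σ, IsProbOn A (q σ)) ∧ ∑ σ ∈ C j, Real.exp (κ * doubledCost (q σ) σ i) ≤
        (elems H).card * (x k ^ (-β) * (1 + β * (1 - (D j).card / (D k).card))) := by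
    intro j hj
    obtain ⟨gj, hgj, hgji⟩ := hO.1 hj
    obtain ⟨g, hg, S, hgjk, hS, hSℓ, hgS⟩ := hG.exists_map_eq hℓ (G.mul_mem hgk (G.inv_mem hgj))
      (show (gk * gj⁻¹) j = k by
        rw [Equiv.Perm.mul_apply, Equiv.Perm.inv_eq_iff_eq.2 hgji.symm, hgki])
    have hSM : 2 * (S.card : ℝ) ^ 2 + 2 ≤ M := by
      have h : (S.card : ℝ) ≤ (ℓ : ℝ) - 1 := by
        have : (S.card : ℝ) + 1 ≤ ℓ := by exact_mod_cast hSℓ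
        linarith
      have := pow_le_pow_left₀ (Nat.cast_nonneg S.card) h 2
      linarith
    have hCj : ∀ σ ∈ C j, σ i = j := fun σ hσ => (Finset.mem_filter.1 hσ).2
    have hCC : ∀ σ ∈ C j, g * σ ∈ C k := fun σ hσ => by
      refine Finset.mem_filter.2 ⟨mem_elems.2 (G.mul_mem hg ?_), ?_⟩
      · exact mem_elems.1 (Finset.mem_filter.1 hσ).1
      · rw [Equiv.Perm.mul_apply, hCj σ hσ, hgjk]
    rw [Real.rpow_def_of_pos hxk]
    rcases (D j).eq_empty_or_nonempty with hempty | hne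
    · obtain ⟨q, hq, hs⟩ := exists_kernel_mix (lam := 0) (b₁ := 0) hκ0 le_rfl zero_le_one hS hSM
        hCj hCC hgS (fun v => ⟨(hk2 v).choose, (hk2 v).choose_spec.1, by simp, by simp⟩) hk2
      refine ⟨q, hq, hs.trans (mul_le_mul_of_nonneg_left ?_ hK.le)⟩
      rw [hempty, zero_mul, zero_add, sub_zero, one_mul, one_pow, mul_one, hκM, Real.exp_add]
      refine mul_le_mul_of_nonneg_left ?_ (Real.exp_pos _).le
      have h := exp_sub_le_one_add h0 h1 zero_le_one le_rfl
      have e : α * 1 - α * 1 ^ 2 / 2 = α / 2 := by ring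
      rw [e, ← hβ] at h
      refine h.trans ?_
      have := mul_nonneg hβ0 (Real.exp_pos (-((1 - α) * 1))).le
      simp only [Finset.card_empty, Nat.cast_zero, zero_div]
      linarith
    · have hDj' : (0 : ℝ) < (D j).card := by exact_mod_cast hne.card_pos
      have hxj : 0 < x j := by positivity
      obtain ⟨lam, hl0, hl1, hlam⟩ := exists_mixing_weight h0 h1
        (r := (D j).card / (D k).card) (by positivity)
        ((div_le_one hDk').2 (by exact_mod_cast hmax j hj))
      obtain ⟨q, hq, hs⟩ := exists_kernel_mix (lam := lam) (b₁ := Real.log (x j) * -β) hκ0 hl0 hl1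
        hS hSM hCj hCC hgS (fun v => by
          obtain ⟨q, hq, hs⟩ := exists_kernel_on_coset hH (hcoset hgj hgji) (hDC j) hne v
          refine ⟨q, fun σ => (hq σ).mono (hDA j), fun σ hσ => ?_, ?_⟩
          · rw [disagreement_eq_zero (hq σ), mul_zero]
            intro τ hτ
            rw [hCj σ hσ, hCj τ (hDC j hτ)]
          · rw [← Real.rpow_def_of_pos hxj]
            exact mul_le_mul_of_nonneg_left hs hl0) hk2
      refine ⟨q, hq, hs.trans (mul_le_mul_of_nonneg_left ?_ hK.le)⟩
      have hlog : Real.log (x j) =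
          Real.log (((D j).card : ℝ) / (D k).card) + Real.log (x k) := by
        rw [← Real.log_mul (by positivity) hxk.ne']
        exact congrArg Real.log (div_mul_div_cancel₀ hDk'.ne').symm
      have e : lam * (Real.log (x j) * -β) + (1 - lam) * (Real.log (x k) * -β) +
          κ * M * (1 - lam) ^ 2 = Real.log (x k) * -β +
          (lam * (-β * Real.log (((D j).card : ℝ) / (D k).card)) + α / 2 * (1 - lam) ^ 2) := by
        rw [hlog, hκM]; ring
      rw [e, Real.exp_add]
      exact mul_le_mul_of_nonneg_left hlam (Real.exp_pos _).le
  choose! Q hQ hQs using hstep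
  obtain ⟨a, ha⟩ := hA
  refine ⟨fun σ => if σ i ∈ O then Q (σ i) σ else Q k σ, fun σ => ?_, ?_⟩
  · dsimp only
    split_ifs with h
    · exact hQ _ h σ
    · exact hQ k hk σ
  rw [← Finset.sum_fiberwise_of_maps_to hmapsG]
  have hAc : (0 : ℝ) < A.card := by exact_mod_cast Finset.card_pos.2 ⟨a, ha⟩
  have hfinal := sum_mixing_bounds_le hβ0 hOne (fun j => ((D j).card : ℝ))
    (by rw [hAcard, Nat.cast_sum]) hAc hDk' hK
  rw [hGcard, Nat.cast_mul]
  refine le_trans (Finset.sum_le_sum fun j hj => ?_) hfinal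
  refine le_trans (le_of_eq (Finset.sum_congr rfl fun σ hσ => ?_)) (hQs j hj)
  dsimp only
  rw [(Finset.mem_filter.1 hσ).2, if_pos hj]

theorem expMomentBound_of_isLLocal {ℓ : ℕ} (hℓ : 2 ≤ ℓ) {α : ℝ} (h0 : 0 < α) (h1 : α < 1)
    (G : Subgroup (Equiv.Perm (Fin n))) (hG : IsLLocal ℓ G) (A : Finset (Equiv.Perm (Fin n)))
    (hAG : ∀ σ ∈ A, σ ∈ G) (hA : A.Nonempty) (i : Fin n) :
    ExpMomentBound (α / (2 * (2 * ((ℓ : ℝ) - 1) ^ 2 + 2))) (α / (1 - α)) G A i := by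
  induction hN : (elems G).card using Nat.strong_induction_on generalizing G A i with
  | _ N ih =>
  have hκ0 : 0 ≤ α / (2 * (2 * ((ℓ : ℝ) - 1) ^ 2 + 2)) := by positivity
  have hmoved : ∀ i', (∃ σ ∈ G, σ i' ≠ i') →
      ExpMomentBound (α / (2 * (2 * ((ℓ : ℝ) - 1) ^ 2 + 2))) (α / (1 - α)) G A i' := by
    rintro i' ⟨σ, hσ, hσi⟩
    refine expMomentBound_of_stabilizer hℓ h0 h1 hG (fun B hB hBne j => ?_) hAG hA
    refine ih _ ?_ _ (hG.inf_stabilizer i') B hB hBne j rfl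
    rw [← hN]
    refine Finset.card_lt_card ⟨fun τ hτ => mem_elems.2 (mem_elems.1 hτ).1, fun h => hσi ?_⟩
    exact (mem_elems.1 (h (mem_elems.2 hσ))).2
  by_cases hfix : ∃ i', ∃ σ ∈ G, σ i' ≠ i'
  · obtain ⟨i', hi'⟩ := hfix
    by_cases hi : ∃ σ ∈ G, σ i ≠ i
    · exact hmoved i hi
    push Not at hi
    obtain ⟨q, hq, hs⟩ := hmoved i' hi'
    refine ⟨q, hq, (Finset.sum_le_sum fun σ hσ => ?_).trans hs⟩
    have hz : disagreement (q σ) σ i = 0 := disagreement_eq_zero (hq σ) fun τ hτ => by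
      rw [hi τ (hAG τ hτ), hi σ (mem_elems.1 hσ)]
    refine Real.exp_le_exp.2 (mul_le_mul_of_nonneg_left ?_ hκ0)
    simp only [doubledCost, hz]
    nlinarith [sq_nonneg (disagreement (q σ) σ i')]
  · push Not at hfix
    obtain ⟨a, ha⟩ := hA
    have hp : IsProbOn A fun τ => if τ = a then 1 else 0 :=
      ⟨fun τ => by dsimp only; split_ifs <;> norm_num, fun τ hτ => if_neg (by rintro rfl; exact hτ ha),
        by simp⟩
    refine ⟨fun _ τ => if τ = a then 1 else 0, fun _ => hp, ?_⟩
    have hz : ∀ σ ∈ elems G, ∀ j, disagreement (fun τ => if τ = a then 1 else 0) σ j = 0 :=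
      fun σ hσ j => disagreement_eq_zero hp fun τ hτ => by
        rw [hfix j τ (hAG τ hτ), hfix j σ (mem_elems.1 hσ)]
    have hone : ∀ σ ∈ elems G, Real.exp (α / (2 * (2 * ((ℓ : ℝ) - 1) ^ 2 + 2)) *
        doubledCost (fun τ => if τ = a then 1 else 0) σ i) = 1 := fun σ hσ => by
      simp [doubledCost, hz σ hσ]
    rw [Finset.sum_congr rfl hone, Finset.sum_const, nsmul_eq_mul]
    have hc : (0 : ℝ) < (elems G).card := by exact_mod_cast card_elems_pos G
    have hAc : (0 : ℝ) < A.card := by exact_mod_cast Finset.card_pos.2 ⟨a, ha⟩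
    refine mul_le_mul_of_nonneg_left ?_ hc.le
    refine Real.one_le_rpow_of_pos_of_le_one_of_nonpos (by positivity) ((div_le_one hc).2 ?_) ?_
    · exact_mod_cast Finset.card_le_card fun σ hσ => mem_elems.2 (hAG σ hσ)
    · exact neg_nonpos.2 (div_nonneg h0.le (by linarith))

end PermutationGroups

/-- Luczak--McDiarmid/Talagrand concentration for the uniform measure on an
`ℓ`-local group, with `c² = 2(ℓ-1)² + 2`. -/
theorem stmt9 {n ℓ : ℕ} (hn : 2 ≤ n) (hℓ : 2 ≤ ℓ) (hℓn : ℓ ≤ n)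
    (G : Subgroup (Equiv.Perm (Fin n))) (hG : IsLLocal ℓ G)
    (A : Finset (Equiv.Perm (Fin n))) (hAG : ∀ σ ∈ A, σ ∈ G) (hA : A.Nonempty)
    (α : ℝ) (hα : α ∈ Set.Ioo (0 : ℝ) 1) (t : ℝ) (ht : 0 ≤ t) :
    (∑ σ ∈ Finset.univ.filter (fun σ : Equiv.Perm (Fin n) => σ ∈ G),
        Real.exp (α * fTal A σ / (2 * (2 * ((ℓ : ℝ) - 1) ^ 2 + 2))) * (Nat.card G : ℝ)⁻¹ ≤
      ((A.card : ℝ) / (Nat.card G : ℝ)) ^ (-(α / (1 - α)))) ∧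
    (∑ σ ∈ Finset.univ.filter (fun σ : Equiv.Perm (Fin n) => σ ∈ G ∧ t ≤ fTal A σ),
        (Nat.card G : ℝ)⁻¹ ≤
      Real.exp (-(α * t) / (2 * (2 * ((ℓ : ℝ) - 1) ^ 2 + 2))) *
        ((A.card : ℝ) / (Nat.card G : ℝ)) ^ (-(α / (1 - α)))) := by
  obtain ⟨h0, h1⟩ := hα
  have hM : (0 : ℝ) < 2 * ((ℓ : ℝ) - 1) ^ 2 + 2 := by positivity
  obtain ⟨q, hq, hs⟩ := expMomentBound_of_isLLocal hℓ h0 h1 G hG A hAG hA ⟨0, by omega⟩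
  have hcard : (Nat.card G : ℝ) = (elems G).card := by
    rw [Nat.card_eq_fintype_card, Fintype.card_subtype]
    simp [elems]
  have hc : (0 : ℝ) < (elems G).card := by exact_mod_cast card_elems_pos G
  have hexp : ∑ σ ∈ elems G,
      Real.exp (α * fTal A σ / (2 * (2 * ((ℓ : ℝ) - 1) ^ 2 + 2))) * (Nat.card G : ℝ)⁻¹ ≤
      ((A.card : ℝ) / (Nat.card G : ℝ)) ^ (-(α / (1 - α))) := by
    rw [← Finset.sum_mul, hcard, ← div_eq_mul_inv, div_le_iff₀' hc]
    refine (Finset.sum_le_sum fun σ _ => Real.exp_le_exp.2 ?_).trans hs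
    rw [mul_div_right_comm]
    exact mul_le_mul_of_nonneg_left (fTal_le_doubledCost (hq σ) σ _) (by positivity)
  refine ⟨hexp, ?_⟩
  rw [neg_div, Real.exp_neg, ← div_eq_inv_mul, le_div_iff₀ (Real.exp_pos _)]
  refine le_trans ?_ hexp
  rw [Finset.sum_mul]
  refine (Finset.sum_le_sum fun σ hσ => ?_).trans (Finset.sum_le_sum_of_subset_of_nonneg
    (fun σ hσ => mem_elems.2 (Finset.mem_filter.1 hσ).2.1) fun σ _ _ => by positivity)
  rw [mul_comm]
  refine mul_le_mul_of_nonneg_right (Real.exp_le_exp.2 ?_) (by positivity)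
  have := (Finset.mem_filter.1 hσ).2.2
  gcongr

end
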